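/- Let Φ, Ψ be arc fields satisfying Conditions A, B, C, and Condition D (commutation law): d(Φ^{s+h}_{2h}(Ψ^s_{2h}(b₁)), Ψ^{s+h}_{2h}(Φ^s_{2h}(b₂))) ≤ d(b₁,b₂)(1+hΠ(b₁,b₂,h)) + C_d·h^{1+α} with Π locally bounded above. Then for every a ∈ X and t ≥ 0 there exist c > 0 and a curve σ : [t,t+c) → X with σ(t) = a such that for every s ∈ [t,t+c): lim_{h→0⁺} d(σ(s+2h), Ψ^{s+h}_{2h}(Φ^s_{2h}(σ(s))))/(2h) = 0. -/

import Mathlib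

/-- A time-dependent arc field: `Φ(s; x, 0) = x`, locally bounded speed, and local
completeness of the ambient metric space around each point. -/
def IsArcField {X : Type*} [MetricSpace X] (Φ : ℝ → X → ℝ → X) : Prop :=
  (∀ (s : ℝ) (x : X), Φ s x 0 = x) ∧
  ∀ (x : X) (t : ℝ), 0 ≤ t → ∃ r > (0 : ℝ), ∃ l > (0 : ℝ), ∃ ρ ≥ (0 : ℝ),
    IsComplete (Metric.closedBall x r) ∧
    ∀ y ∈ Metric.ball x r, ∀ s : ℝ, |s - t| ≤ l →
      ∀ h₁ ∈ Set.Icc (0 : ℝ) 1, ∀ h₂ ∈ Set.Icc (0 : ℝ) 1,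
        dist (Φ s y h₁) (Φ s y h₂) ≤ ρ * |h₁ - h₂|

/-- Condition A: local spatial Lipschitz bound with factor `1 + hK`. -/
def CondA {X : Type*} [MetricSpace X] (Φ : ℝ → X → ℝ → X) : Prop :=
  ∀ (a : X) (t : ℝ), 0 ≤ t → ∃ r > (0 : ℝ), ∃ ε ∈ Set.Ioc (0 : ℝ) 1, ∃ T > t, ∃ K : ℝ,
    ∀ x ∈ Metric.ball a r, ∀ y ∈ Metric.ball a r, ∀ h ∈ Set.Icc 0 ε,
      ∀ s ∈ Set.Icc t T, dist (Φ s x h) (Φ s y h) ≤ dist x y * (1 + h * K)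

/-- Condition B: semigroup defect `≤ h·g(l,h)·K` with `g → 0` and dyadically summable. -/
def CondB {X : Type*} [MetricSpace X] (Φ : ℝ → X → ℝ → X) : Prop :=
  ∀ (a : X) (t : ℝ), 0 ≤ t → ∃ r > (0 : ℝ), ∃ ε ∈ Set.Ioc (0 : ℝ) 1, ∃ T > t,
    ∃ K : ℝ, ∃ g : ℝ → ℝ → ℝ,
      (∀ u v, 0 ≤ g u v) ∧
      Filter.Tendsto (fun q : ℝ × ℝ => g q.1 q.2)
        ((nhdsWithin 0 (Set.Ioi 0)) ×ˢ (nhdsWithin 0 (Set.Ioi 0))) (nhds 0) ∧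
      (Summable fun i : ℕ => g (1 / 2 ^ i) (1 / 2 ^ i)) ∧
      ∀ b ∈ Metric.ball a r, ∀ l ∈ Set.Icc 0 ε, ∀ h ∈ Set.Icc 0 ε, ∀ s ∈ Set.Icc t T,
        dist (Φ s b (l + h)) (Φ s (Φ s b l) h) ≤ h * g l h * K

/-- Condition C: local Hölder continuity in the time parameter. -/
def CondC {X : Type*} [MetricSpace X] (Φ : ℝ → X → ℝ → X) : Prop :=
  ∀ (a : X) (t : ℝ), 0 ≤ t → ∃ r > (0 : ℝ), ∃ ε ∈ Set.Ioc (0 : ℝ) 1, ∃ T > t,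
    ∃ C > (0 : ℝ), ∃ α ∈ Set.Ioo (0 : ℝ) 1,
      ∀ b ∈ Metric.ball a r, ∀ h ∈ Set.Icc 0 ε, ∀ s₁ ∈ Set.Icc t T, ∀ s₂ ∈ Set.Icc t T,
        dist (Φ s₁ b h) (Φ s₂ b h) ≤ C * h * |s₁ - s₂| ^ α

/-- Condition D: commutation law between the two arc fields `Φ` and `Ψ`. -/
def CondD {X : Type*} [MetricSpace X] (Φ Ψ : ℝ → X → ℝ → X) : Prop :=
  ∃ α ∈ Set.Ioo (0 : ℝ) 1, ∃ C_d > (0 : ℝ),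
    ∀ (a : X) (t : ℝ), 0 ≤ t → ∃ r > (0 : ℝ), ∃ ε ∈ Set.Ioc (0 : ℝ) 1, ∃ T > t, ∃ K : ℝ,
      ∀ b₁ ∈ Metric.ball a r, ∀ b₂ ∈ Metric.ball a r, ∀ h ∈ Set.Icc 0 ε,
        ∀ s, s ∈ Set.Icc t T → s + h ∈ Set.Icc t T →
          dist (Φ (s + h) (Ψ s b₁ (2 * h)) (2 * h)) (Ψ (s + h) (Φ s b₂ (2 * h)) (2 * h)) ≤
            dist b₁ b₂ * (1 + h * K) + C_d * h ^ (1 + α)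


/-- The Euler polygon with step `h` of the one-step scheme `E`, started from `y` at time `s`. -/
def eulerPolygon {X : Type*} (E : ℝ → X → ℝ → X) (s h : ℝ) (y : X) : ℕ → X
  | 0 => y
  | k + 1 => E (s + k * h) (eulerPolygon E s h y k) h

theorem eulerPolygon_add {X : Type*} (E : ℝ → X → ℝ → X) (s h : ℝ) (y : X) (i k : ℕ) :
    eulerPolygon E s h y (i + k) = eulerPolygon E (s + i * h) h (eulerPolygon E s h y i) k := by
  induction k with
  | zero => rfl
  | succ k ih =>
    rw [← add_assoc, eulerPolygon, eulerPolygon, ih]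
    push_cast
    congr 1
    ring

/-- The Euler polygon from `a` at time `t` with step `H / 2 ^ n`, read off at the last node before
time `t + u`. -/
noncomputable def dyadicPolygon {X : Type*} (E : ℝ → X → ℝ → X) (a : X) (t H u : ℝ) (n : ℕ) : X :=
  eulerPolygon E t (H / 2 ^ n) a ⌊u / (H / 2 ^ n)⌋₊

/-- A one-step scheme on `ball a R` and the time interval `[t, t + c]` that is Lipschitz in the
step and in space, continuous in time, whose halving defect along the dyadic steps `H / 2 ^ n` is
`δ n` per unit of time, and whose defect for splitting off one of finitely many equal steps is
negligible. -/
structure IsConsistentScheme {X : Type*} [MetricSpace X] (E : ℝ → X → ℝ → X) (a : X)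
    (t c R K H : ℝ) (δ : ℕ → ℝ) : Prop where
  K_nonneg : 0 ≤ K
  H_pos : 0 < H
  mul_lt : K * c < R
  zero : ∀ s x, E s x 0 = x
  step : ∀ s ∈ Set.Icc t (t + c), ∀ x ∈ Metric.ball a R, ∀ h ∈ Set.Icc 0 H, ∀ h' ∈ Set.Icc 0 H,
    dist (E s x h) (E s x h') ≤ K * |h - h'|
  space : ∀ s ∈ Set.Icc t (t + c), ∀ x ∈ Metric.ball a R, ∀ y ∈ Metric.ball a R,
    ∀ h ∈ Set.Icc 0 H, dist (E s x h) (E s y h) ≤ (1 + K * h) * dist x y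
  time : ∀ ζ > 0, ∃ θ > 0, ∀ s ∈ Set.Icc t (t + c), ∀ s' ∈ Set.Icc t (t + c), |s - s'| < θ →
    ∀ x ∈ Metric.ball a R, ∀ h ∈ Set.Icc 0 H, dist (E s x h) (E s' x h) ≤ ζ * h
  halving : ∀ (n : ℕ) (s : ℝ), t ≤ s → s + H / 2 ^ n ≤ t + c → ∀ x ∈ Metric.ball a R,
    dist (E s x (H / 2 ^ n)) (E (s + H / 2 ^ n / 2) (E s x (H / 2 ^ n / 2)) (H / 2 ^ n / 2))
      ≤ H / 2 ^ n * δ n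
  delta_nonneg : ∀ n, 0 ≤ δ n
  summable : Summable δ
  splitting : ∀ (k : ℕ), ∀ ζ > 0, ∃ h₁ > 0, ∀ h ∈ Set.Ioo 0 h₁, ∀ j < k, ∀ s, t ≤ s →
    s + (j + 1) * h ≤ t + c → ∀ x ∈ Metric.ball a R,
      dist (E s x ((j + 1) * h)) (E (s + j * h) (E s x (j * h)) h) ≤ ζ * h

namespace IsConsistentScheme

variable {X : Type*} [MetricSpace X] {E : ℝ → X → ℝ → X} {a : X} {t c R K H : ℝ} {δ : ℕ → ℝ}

theorem dist_step_self (hE : IsConsistentScheme E a t c R K H δ) {s h : ℝ} {x : X}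
    (hs : s ∈ Set.Icc t (t + c)) (hx : x ∈ Metric.ball a R) (hh : h ∈ Set.Icc 0 H) :
    dist (E s x h) x ≤ K * h := by
  have := hE.step s hs x hx h hh 0 ⟨le_rfl, hE.H_pos.le⟩
  rwa [hE.zero, sub_zero, abs_of_nonneg hh.1] at this

theorem dist_eulerPolygon_le (hE : IsConsistentScheme E a t c R K H δ) {s h : ℝ} {y : X}
    (hh : h ∈ Set.Icc 0 H) (ht : t ≤ s) (k : ℕ) (hs : s + k * h ≤ t + c)
    (hy : dist y a + K * (k * h) < R) : dist (eulerPolygon E s h y k) y ≤ K * (k * h) := by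
  induction k with
  | zero => simp [eulerPolygon]
  | succ k ih =>
    push_cast at hs hy ⊢
    have h0 := hh.1
    have hKh : 0 ≤ K * h := mul_nonneg hE.K_nonneg h0
    have hkh : 0 ≤ k * h := by positivity
    have ih := ih (by linarith) (by linarith)
    have hball : eulerPolygon E s h y k ∈ Metric.ball a R := by
      have := dist_triangle (eulerPolygon E s h y k) y a
      rw [Metric.mem_ball]
      linarith
    have h1 := hE.dist_step_self (s := s + k * h) ⟨by linarith, by linarith⟩ hball hh
    have := dist_triangle (eulerPolygon E s h y (k + 1)) (eulerPolygon E s h y k) y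
    rw [eulerPolygon] at this ⊢
    linarith

theorem eulerPolygon_mem_ball (hE : IsConsistentScheme E a t c R K H δ) {s h : ℝ} {y : X}
    (hh : h ∈ Set.Icc 0 H) (ht : t ≤ s) (k : ℕ) (hs : s + k * h ≤ t + c)
    (hy : dist y a + K * (k * h) < R) : eulerPolygon E s h y k ∈ Metric.ball a R := by
  have := hE.dist_eulerPolygon_le hh ht k hs hy
  have := dist_triangle (eulerPolygon E s h y k) y a
  rw [Metric.mem_ball]
  linarith

theorem div_two_pow_mem (hE : IsConsistentScheme E a t c R K H δ) (n : ℕ) :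
    H / 2 ^ n ∈ Set.Icc 0 H :=
  ⟨by have := hE.H_pos; positivity, div_le_self hE.H_pos.le (one_le_pow₀ one_le_two)⟩

/-- Halving the step changes the Euler polygon by at most the accumulated halving defects. -/
theorem dist_eulerPolygon_halving (hE : IsConsistentScheme E a t c R K H δ) (n : ℕ) {s : ℝ}
    {y : X} (ht : t ≤ s) (k : ℕ) (hs : s + k * (H / 2 ^ n) ≤ t + c)
    (hy : dist y a + K * (k * (H / 2 ^ n)) < R) :
    dist (eulerPolygon E s (H / 2 ^ (n + 1)) y (2 * k)) (eulerPolygon E s (H / 2 ^ n) y k)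
      ≤ Real.exp (K * (k * (H / 2 ^ n))) * (k * (H / 2 ^ n) * δ n) := by
  have hhm := hE.div_two_pow_mem n
  have hhm' := hE.div_two_pow_mem (n + 1)
  have hhalf : H / 2 ^ (n + 1) = H / 2 ^ n / 2 := by rw [pow_succ, div_mul_eq_div_div]
  have hdef := hE.halving n
  rw [hhalf] at hhm' ⊢
  set h := H / 2 ^ n with hh
  clear_value h
  have h0 := hhm.1
  induction k with
  | zero => simp [eulerPolygon]
  | succ k ih =>
    push_cast at hs hy ⊢
    have hK := hE.K_nonneg
    have hKh : 0 ≤ K * h := mul_nonneg hK h0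
    have hkh : 0 ≤ k * h := by positivity
    have ih := ih (by linarith) (by linarith)
    set P := eulerPolygon E s h y
    set Q := eulerPolygon E s (h / 2) y with hQ
    have hcast : ((2 * k : ℕ) : ℝ) * (h / 2) = k * h := by push_cast; ring
    have hPk : P k ∈ Metric.ball a R :=
      hE.eulerPolygon_mem_ball hhm ht k (by linarith) (by linarith)
    have hQk : Q (2 * k) ∈ Metric.ball a R :=
      hE.eulerPolygon_mem_ball hhm' ht (2 * k) (by linarith) (by rw [hcast]; linarith)
    have e1 : Q (2 * (k + 1)) =
        E (s + k * h + h / 2) (E (s + k * h) (Q (2 * k)) (h / 2)) (h / 2) := by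
      have t1 : s + (2 * k + 1 : ℕ) * (h / 2) = s + k * h + h / 2 := by push_cast; ring
      rw [hQ, show 2 * (k + 1) = 2 * k + 1 + 1 by ring, eulerPolygon, eulerPolygon, t1, hcast]
    have e2 : P (k + 1) = E (s + k * h) (P k) h := rfl
    have d1 := hdef (s + k * h) (by linarith) (by linarith) _ hQk
    have d2 := hE.space (s + k * h) ⟨by linarith, by linarith⟩ _ hQk _ hPk h hhm
    have tri := dist_triangle_left (Q (2 * (k + 1))) (P (k + 1)) (E (s + k * h) (Q (2 * k)) h)
    rw [e1, e2] at tri ⊢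
    set x := Real.exp (K * (k * h))
    have hx : 1 ≤ x := Real.one_le_exp (by positivity)
    have hexp : Real.exp (K * ((k + 1) * h)) = x * Real.exp (K * h) := by
      rw [← Real.exp_add]; ring_nf
    have hexp1 : 1 + K * h ≤ Real.exp (K * h) := by
      have := Real.add_one_le_exp (K * h); linarith
    have hδ : 0 ≤ h * δ n := mul_nonneg h0 (hE.delta_nonneg n)
    have hkδ : 0 ≤ k * h * δ n := mul_nonneg hkh (hE.delta_nonneg n)
    have hy1 : 1 ≤ Real.exp (K * h) := Real.one_le_exp hKh
    calc _ ≤ h * δ n + (1 + K * h) * dist (Q (2 * k)) (P k) := by linarith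
      _ ≤ (x * Real.exp (K * h)) * (h * δ n) + Real.exp (K * h) * (x * (k * h * δ n)) := by
        refine add_le_add
          (le_mul_of_one_le_left hδ (one_le_mul_of_one_le_of_one_le hx hy1)) ?_
        gcongr
      _ = _ := by rw [hexp]; ring

/-- One step of length `H / 2 ^ m` compared with its `i`-fold halved subdivision. -/
theorem dist_eulerPolygon_pow_le (hE : IsConsistentScheme E a t c R K H δ) (m i : ℕ) {s : ℝ}
    {y : X} (ht : t ≤ s) (hs : s + H / 2 ^ m ≤ t + c) (hy : dist y a + K * (H / 2 ^ m) < R) :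
    dist (eulerPolygon E s (H / 2 ^ (m + i)) y (2 ^ i)) (E s y (H / 2 ^ m))
      ≤ H / 2 ^ m * (Real.exp (K * (H / 2 ^ m)) * ∑ l ∈ Finset.range i, δ (m + l)) := by
  induction i with
  | zero => simp [eulerPolygon]
  | succ i ih =>
    have hc : ((2 ^ i : ℕ) : ℝ) * (H / 2 ^ (m + i)) = H / 2 ^ m := by
      push_cast; rw [pow_add]; field_simp
    have h1 := hE.dist_eulerPolygon_halving (m + i) (y := y) ht (2 ^ i) (by rw [hc]; exact hs)
      (by rw [hc]; exact hy)
    rw [hc] at h1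
    have tri := dist_triangle (eulerPolygon E s (H / 2 ^ (m + (i + 1))) y (2 ^ (i + 1)))
      (eulerPolygon E s (H / 2 ^ (m + i)) y (2 ^ i)) (E s y (H / 2 ^ m))
    rw [Finset.sum_range_succ]
    rw [pow_succ', ← add_assoc] at tri ⊢
    linarith

theorem floor_mul_le (hE : IsConsistentScheme E a t c R K H δ) {u : ℝ} (hu : 0 ≤ u) (n : ℕ) :
    ⌊u / (H / 2 ^ n)⌋₊ * (H / 2 ^ n) ≤ u := by
  have hH := hE.H_pos
  have h0 : 0 < H / 2 ^ n := by positivity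
  have := Nat.floor_le (show 0 ≤ u / (H / 2 ^ n) by positivity)
  rwa [le_div_iff₀ h0] at this

theorem lt_floor_add_one_mul (hE : IsConsistentScheme E a t c R K H δ) (u : ℝ) (n : ℕ) :
    u < (⌊u / (H / 2 ^ n)⌋₊ + 1) * (H / 2 ^ n) := by
  have hH := hE.H_pos
  have h0 : 0 < H / 2 ^ n := by positivity
  have := Nat.lt_floor_add_one (u / (H / 2 ^ n))
  rwa [div_lt_iff₀ h0] at this

theorem start_lt (hE : IsConsistentScheme E a t c R K H δ) {v : ℝ} (hv : v ≤ c) :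
    dist a a + K * v < R := by
  have := mul_le_mul_of_nonneg_left hv hE.K_nonneg
  have := hE.mul_lt
  rw [dist_self]
  linarith

theorem dist_nodes_le (hE : IsConsistentScheme E a t c R K H δ) (n : ℕ) {p q : ℕ} (hpq : p ≤ q)
    (hq : q * (H / 2 ^ n) ≤ c) :
    dist (eulerPolygon E t (H / 2 ^ n) a q) (eulerPolygon E t (H / 2 ^ n) a p)
      ≤ K * ((q - p) * (H / 2 ^ n)) := by
  obtain ⟨k, rfl⟩ := Nat.exists_eq_add_of_le hpq
  have hh := hE.div_two_pow_mem n
  set h := H / 2 ^ n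
  have h0 := hh.1
  push_cast at hq
  have hkh : 0 ≤ k * h := by positivity
  have hph : 0 ≤ p * h := by positivity
  have hp := hE.dist_eulerPolygon_le (y := a) hh le_rfl p (by linarith)
    (hE.start_lt (by linarith))
  have hR := hE.start_lt hq
  rw [dist_self] at hR
  rw [eulerPolygon_add]
  convert hE.dist_eulerPolygon_le hh (by linarith : t ≤ t + p * h) k (by linarith) (by linarith)
    using 3
  push_cast; ring

theorem dist_dyadicPolygon_start_le (hE : IsConsistentScheme E a t c R K H δ) {u : ℝ}
    (hu : u ∈ Set.Icc 0 c) (n : ℕ) : dist (dyadicPolygon E a t H u n) a ≤ K * u := by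
  have h1 := hE.floor_mul_le hu.1 n
  have h2 := hE.dist_nodes_le n (Nat.zero_le _) (h1.trans hu.2)
  rw [Nat.cast_zero, sub_zero] at h2
  exact h2.trans (mul_le_mul_of_nonneg_left h1 hE.K_nonneg)

theorem dist_dyadicPolygon_le (hE : IsConsistentScheme E a t c R K H δ) {u v : ℝ}
    (hu : 0 ≤ u) (huv : u ≤ v) (hv : v ≤ c) (n : ℕ) :
    dist (dyadicPolygon E a t H v n) (dyadicPolygon E a t H u n) ≤ K * (v - u + H / 2 ^ n) := by
  have hh := hE.div_two_pow_mem n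
  have h1 := hE.floor_mul_le (hu.trans huv) n
  have h2 := hE.lt_floor_add_one_mul u n
  have h3 := hE.dist_nodes_le n
    (Nat.floor_le_floor (div_le_div_of_nonneg_right huv hh.1)) (h1.trans hv)
  refine h3.trans (mul_le_mul_of_nonneg_left ?_ hE.K_nonneg)
  linarith

theorem dist_dyadicPolygon_succ_le (hE : IsConsistentScheme E a t c R K H δ) {u : ℝ}
    (hu : u ∈ Set.Icc 0 c) (n : ℕ) :
    dist (dyadicPolygon E a t H u n) (dyadicPolygon E a t H u (n + 1))
      ≤ Real.exp (K * c) * (c * δ n) + K * (H / 2 ^ n) := by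
  have hK := hE.K_nonneg
  have hH := hE.H_pos
  have hδ := hE.delta_nonneg n
  have h1 := hE.floor_mul_le hu.1 n
  have h2 := hE.lt_floor_add_one_mul u n
  have h1' := hE.floor_mul_le hu.1 (n + 1)
  have hhalf : H / 2 ^ (n + 1) = H / 2 ^ n / 2 := by rw [pow_succ, div_mul_eq_div_div]
  have hh : 0 < H / 2 ^ n := by positivity
  unfold dyadicPolygon
  have hpq : 2 * ⌊u / (H / 2 ^ n)⌋₊ ≤ ⌊u / (H / 2 ^ (n + 1))⌋₊ := by
    refine Nat.le_floor ?_
    rw [hhalf, le_div_iff₀ (by positivity)]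
    push_cast
    linarith
  set p := ⌊u / (H / 2 ^ n)⌋₊
  set q := ⌊u / (H / 2 ^ (n + 1))⌋₊
  have h3 := hE.dist_eulerPolygon_halving n (y := a) le_rfl p (by linarith [hu.2])
    (hE.start_lt (h1.trans hu.2))
  have h4 := hE.dist_nodes_le (n + 1) hpq (h1'.trans hu.2)
  have hc : 0 ≤ c := hu.1.trans hu.2
  have hpc : p * (H / 2 ^ n) ≤ c := h1.trans hu.2
  have h5 : K * ((q - (2 * p : ℕ)) * (H / 2 ^ (n + 1))) ≤ K * (H / 2 ^ n) := by
    refine mul_le_mul_of_nonneg_left ?_ hK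
    rw [hhalf] at h1' ⊢
    push_cast
    linarith
  have h6 : Real.exp (K * (p * (H / 2 ^ n))) * (p * (H / 2 ^ n) * δ n)
      ≤ Real.exp (K * c) * (c * δ n) := by gcongr
  have tri := dist_triangle_left (eulerPolygon E t (H / 2 ^ n) a p)
    (eulerPolygon E t (H / 2 ^ (n + 1)) a q) (eulerPolygon E t (H / 2 ^ (n + 1)) a (2 * p))
  rw [dist_comm] at h4
  linarith

theorem tendsto_step_zero (H : ℝ) :
    Filter.Tendsto (fun n : ℕ => H / 2 ^ n) Filter.atTop (nhds 0) := by
  have := (tendsto_pow_atTop_nhds_zero_of_lt_one (r := (1 / 2 : ℝ)) (by norm_num)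
    (by norm_num)).const_mul H
  simpa [div_eq_mul_inv] using this

theorem exists_tendsto_dyadicPolygon (hE : IsConsistentScheme E a t c R K H δ) {r : ℝ}
    (hr : IsComplete (Metric.closedBall a r)) (hRr : R ≤ r) {u : ℝ} (hu : u ∈ Set.Icc 0 c) :
    ∃ x, Filter.Tendsto (dyadicPolygon E a t H u) Filter.atTop (nhds x) := by
  have hsum : Summable fun n => Real.exp (K * c) * (c * δ n) + K * (H / 2 ^ n) := by
    refine ((hE.summable.mul_left c).mul_left _).add (Summable.mul_left K ?_)
    have := (summable_geometric_two).mul_left H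
    simpa [div_eq_mul_inv] using this
  have hcau := cauchySeq_of_dist_le_of_summable _ (hE.dist_dyadicPolygon_succ_le hu) hsum
  have hmem : ∀ n, dyadicPolygon E a t H u n ∈ Metric.closedBall a r := by
    intro n
    have h1 := hE.dist_dyadicPolygon_start_le hu n
    have h2 := mul_le_mul_of_nonneg_left hu.2 hE.K_nonneg
    have h3 := hE.mul_lt
    rw [Metric.mem_closedBall]
    linarith
  obtain ⟨x, -, hx⟩ := cauchySeq_tendsto_of_isComplete hr hmem hcau
  exact ⟨x, hx⟩

/-- The limit curve of the Euler polygons: Lipschitz, and at each dyadic node it follows the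
scheme up to the tail of the halving defects. -/
theorem exists_limit_curve (hE : IsConsistentScheme E a t c R K H δ) {r : ℝ}
    (hr : IsComplete (Metric.closedBall a r)) (hRr : R ≤ r) (hc : 0 ≤ c) :
    ∃ σ : ℝ → X, σ t = a ∧ (∀ s ∈ Set.Icc t (t + c), dist (σ s) a ≤ K * (s - t)) ∧
      (∀ s s', t ≤ s → s ≤ s' → s' ≤ t + c → dist (σ s') (σ s) ≤ K * (s' - s)) ∧
      ∀ m j : ℕ, (j + 1) * (H / 2 ^ m) ≤ c →
        dist (σ (t + (j + 1) * (H / 2 ^ m)))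
            (E (t + j * (H / 2 ^ m)) (σ (t + j * (H / 2 ^ m))) (H / 2 ^ m))
          ≤ H / 2 ^ m * (Real.exp (K * H) * ∑' l, δ (m + l)) := by
  have hex : ∀ s, ∃ x, s ∈ Set.Icc t (t + c) →
      Filter.Tendsto (dyadicPolygon E a t H (s - t)) Filter.atTop (nhds x) := by
    intro s
    by_cases hs : s ∈ Set.Icc t (t + c)
    · obtain ⟨x, hx⟩ := hE.exists_tendsto_dyadicPolygon hr hRr (u := s - t)
        ⟨by linarith [hs.1], by linarith [hs.2]⟩
      exact ⟨x, fun _ => hx⟩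
    · exact ⟨a, fun h => absurd h hs⟩
  choose σ hσ using hex
  have hK := hE.K_nonneg
  have hH := hE.H_pos
  refine ⟨σ, ?_, ?_, ?_, ?_⟩
  · refine tendsto_nhds_unique (hσ t ⟨le_rfl, by linarith⟩) ?_
    refine tendsto_const_nhds.congr fun n => ?_
    simp [dyadicPolygon, eulerPolygon]
  · intro s hs
    exact le_of_tendsto ((hσ s hs).dist tendsto_const_nhds) (Filter.Eventually.of_forall fun n =>
      hE.dist_dyadicPolygon_start_le ⟨by linarith [hs.1], by linarith [hs.2]⟩ n)
  · intro s s' hs hss' hs'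
    have h1 := (hσ s' ⟨by linarith, hs'⟩).dist (hσ s ⟨hs, by linarith⟩)
    have h2 : Filter.Tendsto (fun n : ℕ => K * (s' - t - (s - t) + H / 2 ^ n)) Filter.atTop
        (nhds (K * (s' - t - (s - t) + 0))) :=
      ((tendsto_step_zero H).const_add _).const_mul K
    have := le_of_tendsto_of_tendsto' h1 h2 fun n =>
      hE.dist_dyadicPolygon_le (by linarith) (by linarith) (by linarith) n
    rwa [show s' - t - (s - t) + 0 = s' - s by ring] at this
  · intro m j hj
    have hm := hE.div_two_pow_mem m
    have hnode : ∀ i p : ℕ, dyadicPolygon E a t H (t + p * (H / 2 ^ m) - t) (m + i)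
        = eulerPolygon E t (H / 2 ^ (m + i)) a (p * 2 ^ i) := by
      intro i p
      have : (t + p * (H / 2 ^ m) - t) / (H / 2 ^ (m + i)) = ((p * 2 ^ i : ℕ) : ℝ) := by
        push_cast; rw [pow_add]; field_simp; ring
      rw [dyadicPolygon, this, Nat.floor_natCast]
    have hlim : ∀ p : ℕ, p * (H / 2 ^ m) ≤ c →
        Filter.Tendsto (fun i => eulerPolygon E t (H / 2 ^ (m + i)) a (p * 2 ^ i)) Filter.atTop
          (nhds (σ (t + p * (H / 2 ^ m)))) := by
      intro p hp
      have h0 : 0 ≤ p * (H / 2 ^ m) := by positivity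
      have := (hσ (t + p * (H / 2 ^ m)) ⟨by linarith, by linarith⟩).comp
        (Filter.tendsto_add_atTop_nat m)
      refine this.congr fun i => ?_
      rw [Function.comp, add_comm i m, hnode]
    have hj0 : 0 ≤ j * (H / 2 ^ m) := by positivity
    have hjc : j * (H / 2 ^ m) ≤ c := by linarith [hm.1]
    have hj1 := hlim (j + 1) (by push_cast; exact hj)
    have hj2 := hlim j hjc
    push_cast at hj1
    set s := t + j * (H / 2 ^ m) with hs
    set h := H / 2 ^ m with hh
    have hRj := hE.start_lt hj
    rw [dist_self] at hRj
    have hscale : ∀ i : ℕ, ((j * 2 ^ i : ℕ) : ℝ) * (H / 2 ^ (m + i)) = j * h := by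
      intro i; rw [hh]; push_cast; rw [pow_add]; field_simp
    have hnear : ∀ i, dist (eulerPolygon E t (H / 2 ^ (m + i)) a (j * 2 ^ i)) a ≤ K * (j * h) := by
      intro i
      rw [← hscale i]
      refine hE.dist_eulerPolygon_le (hE.div_two_pow_mem _) le_rfl _ ?_ (hE.start_lt ?_)
      · rw [hscale]; linarith
      · rw [hscale]; exact hjc
    have hσa : dist (σ s) a ≤ K * (j * h) :=
      le_of_tendsto (hj2.dist tendsto_const_nhds) (Filter.Eventually.of_forall hnear)
    have hKh : 0 ≤ K * h := mul_nonneg hK hm.1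
    have hsI : s ∈ Set.Icc t (t + c) := ⟨by linarith, by linarith⟩
    have hσb : σ s ∈ Metric.ball a R := by rw [Metric.mem_ball]; linarith
    have hxb : ∀ i, eulerPolygon E t (H / 2 ^ (m + i)) a (j * 2 ^ i) ∈ Metric.ball a R := by
      intro i; rw [Metric.mem_ball]; linarith [hnear i]
    have hElim : Filter.Tendsto
        (fun i => E s (eulerPolygon E t (H / 2 ^ (m + i)) a (j * 2 ^ i)) h) Filter.atTop
        (nhds (E s (σ s) h)) := by
      rw [tendsto_iff_dist_tendsto_zero] at hj2 ⊢
      refine squeeze_zero (fun _ => dist_nonneg)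
        (fun i => hE.space s hsI _ (hxb i) _ hσb h hm) ?_
      simpa using hj2.const_mul (1 + K * h)
    refine le_of_tendsto (hj1.dist hElim) (Filter.Eventually.of_forall fun i => ?_)
    have hstep := hE.dist_eulerPolygon_pow_le m i (s := s)
      (y := eulerPolygon E t (H / 2 ^ (m + i)) a (j * 2 ^ i)) hsI.1 (by linarith)
      (by linarith [hnear i])
    have hsplit : eulerPolygon E t (H / 2 ^ (m + i)) a ((j + 1) * 2 ^ i)
        = eulerPolygon E s (H / 2 ^ (m + i))
          (eulerPolygon E t (H / 2 ^ (m + i)) a (j * 2 ^ i)) (2 ^ i) := by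
      rw [add_mul, one_mul, eulerPolygon_add, hscale]
    rw [hsplit]
    refine hstep.trans ?_
    have hsumm : Summable fun l => δ (m + l) := by
      simpa only [add_comm] using (summable_nat_add_iff m).2 hE.summable
    have h1 : ∑ l ∈ Finset.range i, δ (m + l) ≤ ∑' l, δ (m + l) :=
      hsumm.sum_le_tsum _ fun l _ => hE.delta_nonneg _
    have h2 : 0 ≤ ∑ l ∈ Finset.range i, δ (m + l) :=
      Finset.sum_nonneg fun l _ => hE.delta_nonneg _
    have h3 := hm.1
    have h4 := hm.2
    gcongr


/-- Accumulation, over finitely many nodes, of the one-step errors of a curve `σ` that follows the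
scheme along the step `h`. -/
theorem dist_node_le (hE : IsConsistentScheme E a t c R K H δ) {σ : ℝ → X} {s h ε : ℝ} {k : ℕ}
    (hσa : ∀ s ∈ Set.Icc t (t + c), dist (σ s) a ≤ K * (s - t)) (hs : t ≤ s) (hh : 0 ≤ h)
    (hkH : k * h ≤ H) (hk : s + k * h ≤ t + c) (hKh : K * h ≤ 1) (hε : 0 ≤ ε)
    (hstep : ∀ j < k, dist (σ (s + (j + 1) * h)) (E (s + j * h) (σ (s + j * h)) h)
      + dist (E s (σ s) ((j + 1) * h)) (E (s + j * h) (E s (σ s) (j * h)) h) ≤ ε) :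
    dist (σ (s + k * h)) (E s (σ s) (k * h)) ≤ 2 ^ k * ε := by
  suffices ∀ j ≤ k, dist (σ (s + j * h)) (E s (σ s) (j * h)) ≤ (2 ^ j - 1) * ε by
    refine (this k le_rfl).trans ?_
    linarith
  intro j
  induction j with
  | zero => simp [hE.zero]
  | succ j ih =>
    intro hjk
    have ih := ih (by omega)
    have hK := hE.K_nonneg
    have hjk' : ((j : ℝ) + 1) * h ≤ k * h :=
      mul_le_mul_of_nonneg_right (by exact_mod_cast hjk) hh
    have hj0 : 0 ≤ j * h := by positivity
    have hKc := hE.mul_lt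
    have hKj : K * (s + j * h - t) ≤ K * c := mul_le_mul_of_nonneg_left (by linarith) hK
    have hKj0 : 0 ≤ K * (j * h) := by positivity
    have hsI : s ∈ Set.Icc t (t + c) := ⟨hs, by linarith⟩
    have hsjI : s + j * h ∈ Set.Icc t (t + c) := ⟨by linarith, by linarith⟩
    have hs1 := hσa s hsI
    have hsb : σ s ∈ Metric.ball a R := by rw [Metric.mem_ball]; linarith
    have hsjb : σ (s + j * h) ∈ Metric.ball a R := by
      rw [Metric.mem_ball]; linarith [hσa _ hsjI]
    have hEb : E s (σ s) (j * h) ∈ Metric.ball a R := by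
      have h1 := hE.dist_step_self hsI hsb (h := j * h) ⟨hj0, by linarith⟩
      have := dist_triangle (E s (σ s) (j * h)) (σ s) a
      rw [Metric.mem_ball]; linarith
    have h1 : h ≤ H := by linarith
    have h2 := hE.space _ hsjI _ hsjb _ hEb h ⟨hh, h1⟩
    have h3 := hstep j (by omega)
    have h4 : (1 + K * h) * dist (σ (s + j * h)) (E s (σ s) (j * h)) ≤ 2 * ((2 ^ j - 1) * ε) :=
      mul_le_mul (by linarith) ih dist_nonneg (by norm_num)
    have t1 := dist_triangle (σ (s + (j + 1) * h)) (E (s + j * h) (σ (s + j * h)) h)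
      (E s (σ s) ((j + 1) * h))
    have t2 := dist_triangle_right (E (s + j * h) (σ (s + j * h)) h) (E s (σ s) ((j + 1) * h))
      (E (s + j * h) (E s (σ s) (j * h)) h)
    push_cast
    rw [pow_succ]
    linarith

theorem exists_dyadic_step (hH : 0 < H) {h : ℝ} (hh : h ∈ Set.Ioc 0 H) {q : ℕ} (hq : 1 ≤ q) :
    ∃ m : ℕ, H / 2 ^ m * q < h ∧ h ≤ 2 * q * (H / 2 ^ m) := by
  have h0 := hh.1
  have hq' : (1 : ℝ) ≤ q := by exact_mod_cast hq
  have hx : 1 ≤ q * H / h := by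
    rw [le_div_iff₀ h0]
    nlinarith [hh.2]
  obtain ⟨m, h1, h2⟩ := exists_nat_pow_near hx one_lt_two
  refine ⟨m + 1, ?_, ?_⟩
  · rw [div_lt_iff₀ h0] at h2
    rw [div_mul_eq_mul_div, div_lt_iff₀ (by positivity)]
    linarith
  · rw [le_div_iff₀ h0] at h1
    rw [pow_succ, mul_div_assoc', le_div_iff₀ (by positivity)]
    linarith

/-- A consistent scheme has a curve tangent to it at every time. -/
theorem exists_curve (hE : IsConsistentScheme E a t c R K H δ) {r : ℝ}
    (hr : IsComplete (Metric.closedBall a r)) (hRr : R ≤ r) (hc : 0 < c) :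
    ∃ σ : ℝ → X, σ t = a ∧ (∀ s ∈ Set.Ico t (t + c), σ s ∈ Metric.ball a R) ∧
      ∀ s ∈ Set.Ico t (t + c),
        Filter.Tendsto (fun h => dist (σ (s + h)) (E s (σ s) h) / h)
          (nhdsWithin 0 (Set.Ioi 0)) (nhds 0) := by
  obtain ⟨σ, hσt, hσa, hσL, hσE⟩ := hE.exists_limit_curve hr hRr hc.le
  have hK := hE.K_nonneg
  have hH := hE.H_pos
  have hKc := hE.mul_lt
  have hball : ∀ s ∈ Set.Icc t (t + c), σ s ∈ Metric.ball a R := by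
    intro s hs
    have : K * (s - t) ≤ K * c := mul_le_mul_of_nonneg_left (by linarith [hs.2]) hK
    rw [Metric.mem_ball]; linarith [hσa s hs]
  refine ⟨σ, hσt, fun s hs => hball s ⟨hs.1, hs.2.le⟩, fun s hs => ?_⟩
  have hsI : s ∈ Set.Icc t (t + c) := ⟨hs.1, hs.2.le⟩
  rw [Metric.tendsto_nhds]
  intro ζ hζ
  set D := 3 * K + (1 + K * H) * K with hD
  obtain ⟨q, hq⟩ := exists_nat_gt (max 1 (D / (ζ / 4)))
  have hq1' : (1 : ℝ) < q := (le_max_left _ _).trans_lt hq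
  have hq1 : 1 ≤ q := by exact_mod_cast hq1'.le
  have hqD : D ≤ q * (ζ / 4) := by
    have := (le_max_right _ _).trans_lt hq
    rw [div_lt_iff₀ (by positivity)] at this
    exact this.le
  set A : ℝ := 2 ^ (2 * q) with hA
  have hA0 : 0 < A := by positivity
  set η := ζ / 4 / (A + 1) with hη
  have hη0 : 0 < η := by positivity
  have hηA : η * (A + 1) = ζ / 4 := by rw [hη]; field_simp
  obtain ⟨θ, hθ, htime⟩ := hE.time η hη0
  obtain ⟨h₁, hh₁, hsplit⟩ := hE.splitting (2 * q) η hη0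
  set B := Real.exp (K * H) with hB
  have hB0 : 0 < B := Real.exp_pos _
  have htail : ∃ m₀ : ℕ, ∀ m ≥ m₀, B * ∑' l, δ (m + l) < η := by
    have h1 := (tendsto_sum_nat_add δ).const_mul B
    rw [mul_zero] at h1
    obtain ⟨m₀, hm₀⟩ := Filter.eventually_atTop.1 (h1.eventually (gt_mem_nhds hη0))
    refine ⟨m₀, fun m hm => ?_⟩
    simpa only [add_comm] using hm₀ m hm
  obtain ⟨m₀, hm₀⟩ := htail
  have hb : 0 < min (min (t + c - s) (min θ h₁)) (min (H / 2 ^ m₀) (1 / (K + 1))) := by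
    refine lt_min (lt_min (by linarith [hs.2]) (lt_min hθ hh₁)) (lt_min ?_ ?_) <;> positivity
  filter_upwards [Ioo_mem_nhdsGT hb] with h hh
  obtain ⟨h0, hlt⟩ := hh
  simp only [lt_min_iff] at hlt
  obtain ⟨⟨hhc, hhθ, hhh₁⟩, hhm, hhK⟩ := hlt
  have hhH : h ≤ H := hhm.le.trans (hE.div_two_pow_mem m₀).2
  obtain ⟨m, hm1, hm2⟩ := exists_dyadic_step hH ⟨h0, hhH⟩ hq1
  have hmH := hE.div_two_pow_mem m
  have hσE := hσE m
  have hd0 : 0 < H / 2 ^ m := by positivity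
  have hdh : H / 2 ^ m < h := lt_of_le_of_lt (le_mul_of_one_le_right hd0.le hq1'.le) hm1
  have hmm : m₀ ≤ m := by
    by_contra hcon
    have : H / 2 ^ m₀ ≤ H / 2 ^ m :=
      div_le_div_of_nonneg_left hH.le (by positivity)
        (pow_le_pow_right₀ one_le_two (not_le.1 hcon).le)
    linarith
  have htail := hm₀ m hmm
  set d := H / 2 ^ m with hd
  have hKd : K * d ≤ 1 := by
    rw [lt_div_iff₀ (by linarith)] at hhK
    nlinarith
  set k := ⌊h / d⌋₊ with hk
  set j := ⌊(s - t) / d⌋₊ with hj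
  have hk1 : k * d ≤ h := hE.floor_mul_le h0.le m
  have hk2 : h < (k + 1) * d := hE.lt_floor_add_one_mul h m
  have hj1 : j * d ≤ s - t := hE.floor_mul_le (by linarith [hs.1]) m
  have hj2 : s - t < (j + 1) * d := hE.lt_floor_add_one_mul (s - t) m
  have hkq : k ≤ 2 * q := by
    have : (k : ℝ) ≤ ((2 * q : ℕ) : ℝ) := by
      push_cast
      exact le_of_mul_le_mul_right (hk1.trans hm2) hd0
    exact_mod_cast this
  have hk0 : 0 ≤ k * d := by positivity
  have hj0 : 0 ≤ j * d := by positivity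
  set s₀ := t + j * d with hs₀
  have hs₀I : s₀ ∈ Set.Icc t (t + c) := ⟨by linarith, by linarith [hs.2]⟩
  have hnode : dist (σ (s₀ + k * d)) (E s₀ (σ s₀) (k * d)) ≤ 2 ^ k * (d * (2 * η)) := by
    refine hE.dist_node_le hσa hs₀I.1 hd0.le (hk1.trans hhH) (by linarith) hKd (by positivity) ?_
    intro i hi
    have hik : ((i : ℝ) + 1) * d ≤ k * d :=
      mul_le_mul_of_nonneg_right (by exact_mod_cast hi) hd0.le
    have e1 := hσE (j + i) (by push_cast; linarith)
    have e2 := hsplit d ⟨hd0, hdh.trans hhh₁⟩ i (by omega) s₀ hs₀I.1 (by linarith) (σ s₀)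
      (hball s₀ hs₀I)
    have i1 : t + (((j + i : ℕ) : ℝ) + 1) * d = s₀ + (i + 1) * d := by push_cast; ring
    have i2 : t + ((j + i : ℕ) : ℝ) * d = s₀ + i * d := by push_cast; ring
    rw [i1, i2] at e1
    have : d * (B * ∑' l, δ (m + l)) ≤ d * η := mul_le_mul_of_nonneg_left htail.le hd0.le
    linarith
  have hpow : 2 ^ k * (d * (2 * η)) ≤ A * (d * (2 * η)) := by
    refine mul_le_mul_of_nonneg_right ?_ (by positivity)
    exact pow_le_pow_right₀ one_le_two hkq
  have f1 := hσL (s₀ + k * d) (s + h) (by linarith) (by linarith) (by linarith)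
  have f1' : K * (s + h - (s₀ + k * d)) ≤ K * (2 * d) :=
    mul_le_mul_of_nonneg_left (by linarith) hK
  have hkI : k * d ∈ Set.Icc 0 H := ⟨hk0, hk1.trans hhH⟩
  have f2 := hE.space s₀ hs₀I _ (hball s₀ hs₀I) _ (hball s hsI) (k * d) hkI
  have f3 := hσL s₀ s hs₀I.1 (by linarith) hsI.2
  have f3' : K * (s - s₀) ≤ K * d := mul_le_mul_of_nonneg_left (by linarith) hK
  rw [dist_comm] at f3
  have f2' : (1 + K * (k * d)) * dist (σ s₀) (σ s) ≤ (1 + K * H) * (K * d) := by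
    refine mul_le_mul ?_ (f3.trans f3') dist_nonneg (by positivity)
    linarith [mul_le_mul_of_nonneg_left hkI.2 hK]
  have f4 := htime s₀ hs₀I s hsI (by rw [abs_lt]; constructor <;> linarith) (σ s) (hball s hsI)
    (k * d) hkI
  have f5 := hE.step s hsI (σ s) (hball s hsI) (k * d) hkI h ⟨h0.le, hhH⟩
  have f5' : K * |k * d - h| ≤ K * d := by
    refine mul_le_mul_of_nonneg_left ?_ hK
    rw [abs_le]; constructor <;> linarith
  have g1 := dist_triangle (σ (s + h)) (σ (s₀ + k * d)) (E s (σ s) h)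
  have g2 := dist_triangle (σ (s₀ + k * d)) (E s₀ (σ s₀) (k * d)) (E s (σ s) h)
  have g3 := dist_triangle (E s₀ (σ s₀) (k * d)) (E s₀ (σ s) (k * d)) (E s (σ s) h)
  have g4 := dist_triangle (E s₀ (σ s) (k * d)) (E s (σ s) (k * d)) (E s (σ s) h)
  have hηk : η * (k * d) ≤ η * h := mul_le_mul_of_nonneg_left hk1 hη0.le
  have hAd : A * (d * (2 * η)) ≤ A * (h * (2 * η)) := by gcongr
  have hDd : D * d ≤ ζ / 4 * h := by
    calc D * d ≤ q * (ζ / 4) * d := mul_le_mul_of_nonneg_right hqD hd0.le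
      _ = ζ / 4 * (d * q) := by ring
      _ ≤ ζ / 4 * h := mul_le_mul_of_nonneg_left hm1.le (by positivity)
  have hηh : η * (A + 1) * h = ζ / 4 * h := by rw [hηA]
  have hζh : 0 < ζ * h := by positivity
  have hηh0 : 0 < η * h := by positivity
  rw [Real.dist_eq, sub_zero, abs_of_nonneg (by positivity), div_lt_iff₀ h0]
  have hDexp : D * d = 3 * (K * d) + (1 + K * H) * (K * d) := by rw [hD]; ring
  have : dist (σ (s + h)) (E s (σ s) h) ≤ D * d + A * (h * (2 * η)) + η * h := by linarith
  linarith

end IsConsistentScheme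

/-- Uniform versions, on `ball a R`, times in `[t, T]` and steps in `[0, ε]`, of the bounds
assumed of an arc field, with one constant `K` and the constant of the semigroup defect absorbed
into `g`. -/
structure ArcFieldBounds {X : Type*} [MetricSpace X] (Φ : ℝ → X → ℝ → X) (a : X)
    (t R ε T K α : ℝ) (g : ℝ → ℝ → ℝ) : Prop where
  zero : ∀ s x, Φ s x 0 = x
  g_nonneg : ∀ u v, 0 ≤ g u v
  g_tendsto : Filter.Tendsto (fun q : ℝ × ℝ => g q.1 q.2)
    ((nhdsWithin 0 (Set.Ioi 0)) ×ˢ (nhdsWithin 0 (Set.Ioi 0))) (nhds 0)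
  g_summable : Summable fun i : ℕ => g (1 / 2 ^ i) (1 / 2 ^ i)
  step : ∀ x ∈ Metric.ball a R, ∀ s ∈ Set.Icc t T, ∀ h ∈ Set.Icc 0 ε, ∀ h' ∈ Set.Icc 0 ε,
    dist (Φ s x h) (Φ s x h') ≤ K * |h - h'|
  space : ∀ x ∈ Metric.ball a R, ∀ y ∈ Metric.ball a R, ∀ h ∈ Set.Icc 0 ε, ∀ s ∈ Set.Icc t T,
    dist (Φ s x h) (Φ s y h) ≤ dist x y * (1 + h * K)
  semigroup : ∀ x ∈ Metric.ball a R, ∀ l ∈ Set.Icc 0 ε, ∀ h ∈ Set.Icc 0 ε, ∀ s ∈ Set.Icc t T,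
    dist (Φ s x (l + h)) (Φ s (Φ s x l) h) ≤ h * g l h
  time : ∀ x ∈ Metric.ball a R, ∀ h ∈ Set.Icc 0 ε, ∀ s ∈ Set.Icc t T, ∀ s' ∈ Set.Icc t T,
    dist (Φ s x h) (Φ s' x h) ≤ K * h * |s - s'| ^ α

namespace ArcFieldBounds

variable {X : Type*} [MetricSpace X] {Φ : ℝ → X → ℝ → X} {a : X} {t R ε T K α : ℝ}
  {g : ℝ → ℝ → ℝ}

theorem mono (hΦ : ArcFieldBounds Φ a t R ε T K α g) {R' ε' T' K' α' : ℝ} (hR : R' ≤ R)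
    (hε : ε' ≤ ε) (hT : T' ≤ T) (hT1 : T' ≤ t + 1) (hK0 : 0 ≤ K) (hK : K ≤ K') (hα0 : 0 ≤ α')
    (hα : α' ≤ α) : ArcFieldBounds Φ a t R' ε' T' K' α' g := by
  have hb := Metric.ball_subset_ball (x := a) hR
  have he := Set.Icc_subset_Icc_right (b := (0 : ℝ)) hε
  have ht := Set.Icc_subset_Icc_right (b := t) hT
  refine ⟨hΦ.zero, hΦ.g_nonneg, hΦ.g_tendsto, hΦ.g_summable, ?_, ?_, ?_, ?_⟩
  · intro x hx s hs h hh h' hh'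
    refine (hΦ.step x (hb hx) s (ht hs) h (he hh) h' (he hh')).trans ?_
    gcongr
  · intro x hx y hy h hh s hs
    refine (hΦ.space x (hb hx) y (hb hy) h (he hh) s (ht hs)).trans ?_
    have := hh.1
    gcongr
  · intro x hx l hl h hh s hs
    exact hΦ.semigroup x (hb hx) l (he hl) h (he hh) s (ht hs)
  · intro x hx h hh s hs s' hs'
    refine (hΦ.time x (hb hx) h (he hh) s (ht hs) s' (ht hs')).trans ?_
    have h1 : |s - s'| ≤ 1 := by
      rw [abs_le]; constructor <;> linarith [hs.1, hs.2, hs'.1, hs'.2]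
    have h2 := Real.rpow_le_rpow_of_exponent_ge' (abs_nonneg _) h1 hα0 hα
    have := hh.1
    have := hK0.trans hK
    gcongr

end ArcFieldBounds

theorem exists_arcFieldBounds {X : Type*} [MetricSpace X] {Φ : ℝ → X → ℝ → X}
    (harc : IsArcField Φ) (hA : CondA Φ) (hB : CondB Φ) (hC : CondC Φ) (a : X) {t : ℝ}
    (ht : 0 ≤ t) :
    ∃ R > 0, ∃ ε > 0, ∃ T > t, ∃ K ≥ 0, ∃ α ∈ Set.Ioo (0 : ℝ) 1, ∃ g : ℝ → ℝ → ℝ,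
      (∃ r ≥ R, IsComplete (Metric.closedBall a r)) ∧ ArcFieldBounds Φ a t R ε T K α g := by
  obtain ⟨r₀, hr₀, l, hl, ρ, hρ, hcomp, hstep⟩ := harc.2 a t ht
  obtain ⟨r₁, hr₁, ε₁, hε₁, T₁, hT₁, K₁, hA⟩ := hA a t ht
  obtain ⟨r₂, hr₂, ε₂, hε₂, T₂, hT₂, K₂, g, hg0, hgt, hgs, hB⟩ := hB a t ht
  obtain ⟨r₃, hr₃, ε₃, hε₃, T₃, hT₃, K₃, hK₃, α, hα, hC⟩ := hC a t ht
  have hK₂ : 0 ≤ max K₂ 0 := le_max_right _ _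
  set R := min (min r₀ r₁) (min r₂ r₃) with hR
  have hR₀ : R ≤ r₀ := (min_le_left _ _).trans (min_le_left _ _)
  have hR₁ : R ≤ r₁ := (min_le_left _ _).trans (min_le_right _ _)
  have hR₂ : R ≤ r₂ := (min_le_right _ _).trans (min_le_left _ _)
  have hR₃ : R ≤ r₃ := (min_le_right _ _).trans (min_le_right _ _)
  set ε := min ε₁ (min ε₂ ε₃) with hε
  have he₁ : ε ≤ ε₁ := min_le_left _ _
  have he₂ : ε ≤ ε₂ := (min_le_right _ _).trans (min_le_left _ _)
  have he₃ : ε ≤ ε₃ := (min_le_right _ _).trans (min_le_right _ _)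
  set T := min (min (t + l) T₁) (min T₂ T₃) with hT
  have ht₀ : T ≤ t + l := (min_le_left _ _).trans (min_le_left _ _)
  have ht₁ : T ≤ T₁ := (min_le_left _ _).trans (min_le_right _ _)
  have ht₂ : T ≤ T₂ := (min_le_right _ _).trans (min_le_left _ _)
  have ht₃ : T ≤ T₃ := (min_le_right _ _).trans (min_le_right _ _)
  set K := max ρ (max K₁ K₃) with hK
  have hk₀ : ρ ≤ K := le_max_left _ _
  have hk₁ : K₁ ≤ K := (le_max_left _ _).trans (le_max_right _ _)
  have hk₃ : K₃ ≤ K := (le_max_right _ _).trans (le_max_right _ _)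
  refine ⟨R, lt_min (lt_min hr₀ hr₁) (lt_min hr₂ hr₃), ε, lt_min hε₁.1 (lt_min hε₂.1 hε₃.1), T,
    lt_min (lt_min (by linarith) hT₁) (lt_min hT₂ hT₃), K, hρ.trans hk₀, α, hα,
    fun u v => max K₂ 0 * g u v,
    ⟨r₀, hR₀, hcomp⟩, harc.1, fun u v => mul_nonneg hK₂ (hg0 u v), ?_, hgs.mul_left _, ?_, ?_, ?_, ?_⟩
  · simpa using hgt.const_mul (max K₂ 0)
  · intro x hx s hs h hh h' hh'
    refine (hstep x (Metric.ball_subset_ball hR₀ hx) s ?_ h ⟨hh.1, ?_⟩ h' ⟨hh'.1, ?_⟩).trans ?_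
    · rw [abs_le]; constructor <;> linarith [hs.1, hs.2]
    · exact hh.2.trans (he₁.trans hε₁.2)
    · exact hh'.2.trans (he₁.trans hε₁.2)
    · gcongr
  · intro x hx y hy h hh s hs
    refine (hA x (Metric.ball_subset_ball hR₁ hx) y (Metric.ball_subset_ball hR₁ hy) h
      ⟨hh.1, hh.2.trans he₁⟩ s ⟨hs.1, hs.2.trans ht₁⟩).trans ?_
    have := hh.1
    gcongr
  · intro x hx l hl h hh s hs
    refine (hB x (Metric.ball_subset_ball hR₂ hx) l ⟨hl.1, hl.2.trans he₂⟩ h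
      ⟨hh.1, hh.2.trans he₂⟩ s ⟨hs.1, hs.2.trans ht₂⟩).trans ?_
    rw [mul_assoc, mul_comm (g l h)]
    have := hh.1
    have := hg0 l h
    gcongr
    exact le_max_left _ _
  · intro x hx h hh s hs s' hs'
    refine (hC x (Metric.ball_subset_ball hR₃ hx) h ⟨hh.1, hh.2.trans he₃⟩ s
      ⟨hs.1, hs.2.trans ht₃⟩ s' ⟨hs'.1, hs'.2.trans ht₃⟩).trans ?_
    have := hh.1
    gcongr

/-- Two arc fields with common uniform bounds and the commutation law. -/
structure CommutingBounds {X : Type*} [MetricSpace X] (Φ Ψ : ℝ → X → ℝ → X) (a : X)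
    (t R ε T K α : ℝ) (g g' : ℝ → ℝ → ℝ) : Prop where
  left : ArcFieldBounds Φ a t R ε T K α g
  right : ArcFieldBounds Ψ a t R ε T K α g'
  one_le : 1 ≤ K
  mul_le : K * ε ≤ 1
  exponent : α ∈ Set.Ioo (0 : ℝ) 1
  comm : ∀ b ∈ Metric.ball a R, ∀ h ∈ Set.Icc 0 ε, ∀ s ∈ Set.Icc t T, s + h ≤ T →
    dist (Φ (s + h) (Ψ s b (2 * h)) (2 * h)) (Ψ (s + h) (Φ s b (2 * h)) (2 * h))
      ≤ K * h ^ (1 + α)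

/-- The alternating one-step scheme: a step of `Φ` followed by a step of `Ψ`. -/
def alternatingStep {X : Type*} (Φ Ψ : ℝ → X → ℝ → X) (s : ℝ) (x : X) (h : ℝ) : X :=
  Ψ s (Φ s x h) h

theorem exists_pos_rpow_le {α y : ℝ} (hα : 0 < α) (hy : 0 < y) :
    ∃ θ > 0, ∀ x, 0 ≤ x → x < θ → x ^ α ≤ y := by
  refine ⟨y ^ α⁻¹, Real.rpow_pos_of_pos hy _, fun x hx hxθ => ?_⟩
  calc x ^ α ≤ (y ^ α⁻¹) ^ α := Real.rpow_le_rpow hx hxθ.le hα.le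
    _ = y := Real.rpow_inv_rpow hy.le hα.ne'

theorem natCast_mul_rpow_le {α h : ℝ} (hα : α ∈ Set.Ioo (0 : ℝ) 1) (hh : 0 ≤ h) (j : ℕ) :
    (j * h) ^ α ≤ 4 ^ j * h ^ α := by
  rw [Real.mul_rpow (Nat.cast_nonneg j) hh]
  refine mul_le_mul_of_nonneg_right ?_ (Real.rpow_nonneg hh α)
  rcases Nat.eq_zero_or_pos j with rfl | hj
  · simp [Real.zero_rpow hα.1.ne']
  · have h1 : (j : ℝ) ^ α ≤ j := by
      simpa using Real.rpow_le_rpow_of_exponent_le (x := (j : ℝ)) (by exact_mod_cast hj) hα.2.le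
    have h2 : (j : ℝ) ≤ 4 ^ j := by exact_mod_cast (Nat.lt_pow_self (by norm_num : 1 < 4)).le
    exact h1.trans h2

namespace ArcFieldBounds

variable {X : Type*} [MetricSpace X] {Φ : ℝ → X → ℝ → X} {a : X} {t R ε T K α : ℝ}
  {g : ℝ → ℝ → ℝ}

theorem dist_self_le (hΦ : ArcFieldBounds Φ a t R ε T K α g) (hK : 0 ≤ K) {s h : ℝ} {x : X}
    (hs : s ∈ Set.Icc t T) (hx : x ∈ Metric.ball a R) (hh : h ∈ Set.Icc 0 ε) :
    dist (Φ s x h) x ≤ K * ε := by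
  have := hΦ.step x hx s hs h hh 0 ⟨le_rfl, hh.1.trans hh.2⟩
  rw [hΦ.zero, sub_zero, abs_of_nonneg hh.1] at this
  exact this.trans (mul_le_mul_of_nonneg_left hh.2 hK)

theorem dist_center_le (hΦ : ArcFieldBounds Φ a t R ε T K α g) (hK : 0 ≤ K) {s h : ℝ} {x : X}
    (hs : s ∈ Set.Icc t T) (hx : dist x a < R) (hh : h ∈ Set.Icc 0 ε) :
    dist (Φ s x h) a ≤ dist x a + K * ε := by
  have := hΦ.dist_self_le hK hs hx hh
  have := dist_triangle (Φ s x h) x a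
  linarith

theorem dist_le_two_mul (hΦ : ArcFieldBounds Φ a t R ε T K α g) (hK : 0 ≤ K) (hKε : K * ε ≤ 1)
    {s h : ℝ} {x y : X} (hs : s ∈ Set.Icc t T) (hx : dist x a < R) (hy : dist y a < R)
    (hh : h ∈ Set.Icc 0 ε) : dist (Φ s x h) (Φ s y h) ≤ 2 * dist x y := by
  refine (hΦ.space x hx y hy h hh s hs).trans ?_
  have : h * K ≤ 1 := by
    have := mul_le_mul_of_nonneg_left hh.2 hK
    linarith
  rw [mul_comm]
  exact mul_le_mul_of_nonneg_right (by linarith) dist_nonneg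

/-- The semigroup defect of splitting off the last of `j + 1` equal steps. -/
theorem dist_succ_mul_le (hΦ : ArcFieldBounds Φ a t R ε T K α g) {s h η : ℝ} {x : X} {j : ℕ}
    (hs : s ∈ Set.Icc t T) (hx : dist x a < R) (hh : h ∈ Set.Icc 0 ε) (hjh : j * h ≤ ε)
    (hη : 0 ≤ η) (hg : 1 ≤ j → g (j * h) h ≤ η) :
    dist (Φ s x ((j + 1) * h)) (Φ s (Φ s x (j * h)) h) ≤ h * η := by
  have h0 := hh.1
  rcases Nat.eq_zero_or_pos j with rfl | hj
  · simpa [hΦ.zero] using mul_nonneg h0 hη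
  · rw [add_mul, one_mul]
    exact (hΦ.semigroup x hx (j * h) ⟨by positivity, hjh⟩ h hh s hs).trans
      (mul_le_mul_of_nonneg_left (hg hj) h0)

end ArcFieldBounds

namespace CommutingBounds

variable {X : Type*} [MetricSpace X] {Φ Ψ : ℝ → X → ℝ → X} {a : X} {t R ε T K α : ℝ}
  {g g' : ℝ → ℝ → ℝ}

theorem dist_swap_le (H : CommutingBounds Φ Ψ a t R ε T K α g g') {s h : ℝ} {b : X}
    (hs : s ∈ Set.Icc t T) (hsT : s + ε ≤ T) (hb : dist b a + K * ε < R)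
    (hh : h ∈ Set.Icc 0 ε) :
    dist (Ψ s (Φ s b h) h) (Φ s (Ψ s b h) h) ≤ 3 * K * (h * h ^ α) := by
  have h0 := hh.1
  have hK : 0 ≤ K := zero_le_one.trans H.one_le
  have hKε : 0 ≤ K * ε := mul_nonneg hK (hh.1.trans hh.2)
  have hs' : s + h / 2 ∈ Set.Icc t T := ⟨by linarith [hs.1], by linarith [hh.2]⟩
  have hbR : dist b a < R := by linarith
  have e1 := H.left.dist_center_le hK hs hbR hh
  have e2 := H.right.dist_center_le hK hs hbR hh
  have c := H.comm b hbR (h / 2) ⟨by positivity, by linarith [hh.2]⟩ s hs hs'.2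
  rw [show 2 * (h / 2) = h by ring] at c
  have l := H.left.time (Ψ s b h) (e2.trans_lt hb) h hh (s + h / 2) hs' s hs
  have r := H.right.time (Φ s b h) (e1.trans_lt hb) h hh (s + h / 2) hs' s hs
  rw [show s + h / 2 - s = h / 2 by ring, abs_of_nonneg (by positivity)] at l r
  have hp : (h / 2) ^ α ≤ h ^ α := Real.rpow_le_rpow (by positivity) (by linarith) H.exponent.1.le
  have hp0 : 0 ≤ h ^ α := Real.rpow_nonneg h0 α
  have hp' : (h / 2) ^ (1 + α) ≤ h * h ^ α := by
    rw [Real.rpow_one_add' (by positivity) (by linarith [H.exponent.1])]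
    gcongr
    linarith
  have m1 : K * h * (h / 2) ^ α ≤ K * h * h ^ α := by gcongr
  have m2 : K * (h / 2) ^ (1 + α) ≤ K * (h * h ^ α) := by gcongr
  have t1 := dist_triangle_left (Ψ s (Φ s b h) h) (Φ s (Ψ s b h) h)
    (Ψ (s + h / 2) (Φ s b h) h)
  have t2 := dist_triangle_left (Ψ (s + h / 2) (Φ s b h) h) (Φ s (Ψ s b h) h)
    (Φ (s + h / 2) (Ψ s b h) h)
  linarith

/-- Commuting one step of `Φ` past a step of `Ψ` that is `j` times longer. -/
theorem dist_swap_mul_le (H : CommutingBounds Φ Ψ a t R ε T K α g g') {s h η : ℝ} {y : X}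
    (hs : s ∈ Set.Icc t T) (hsT : s + ε ≤ T) (hy : dist y a + 2 * (K * ε) < R)
    (hh : h ∈ Set.Icc 0 ε) (hη : 0 ≤ η) (j : ℕ) (hjh : j * h ≤ ε)
    (hg : ∀ i : ℕ, 1 ≤ i → i < j → g' (i * h) h ≤ η) :
    dist (Ψ s (Φ s y h) (j * h)) (Φ s (Ψ s y (j * h)) h) ≤ 4 ^ j * (3 * K * (h * (η + h ^ α))) := by
  have h0 := hh.1
  have hK1 := H.one_le
  have hK : 0 ≤ K := zero_le_one.trans hK1
  have hKε : 0 ≤ K * ε := mul_nonneg hK (hh.1.trans hh.2)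
  have hp0 : 0 ≤ h ^ α := Real.rpow_nonneg h0 α
  have hhη : 0 ≤ h * η := mul_nonneg h0 hη
  have hhα : 0 ≤ h * h ^ α := mul_nonneg h0 hp0
  induction j with
  | zero =>
    simp only [Nat.cast_zero, zero_mul, H.right.zero, dist_self]
    positivity
  | succ j ih =>
    push_cast at hjh ⊢
    have hj0 : 0 ≤ j * h := by positivity
    have hjε : j * h ≤ ε := by linarith
    have ih := ih hjε fun i h1 h2 => hg i h1 (by omega)
    have hjI : j * h ∈ Set.Icc 0 ε := ⟨hj0, hjε⟩
    have hj1I : (j + 1) * h ∈ Set.Icc 0 ε := ⟨by positivity, hjh⟩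
    have hyR : dist y a < R := by linarith
    have hgj : 1 ≤ j → g' (j * h) h ≤ η := fun h1 => hg j h1 (by omega)
    have p1 := H.left.dist_center_le hK hs hyR hh
    have p2 := H.right.dist_center_le hK hs (by linarith) hjI (x := Φ s y h)
    have p3 := H.right.dist_center_le hK hs hyR hjI
    have p4 := H.left.dist_center_le hK hs (by linarith) hh (x := Ψ s y (j * h))
    have p5 := H.right.dist_center_le hK hs (by linarith) hh (x := Ψ s y (j * h))
    have p6 := H.right.dist_center_le hK hs hyR hj1I
    have d1 := H.right.dist_succ_mul_le hs (by linarith) hh hjε hη hgj (x := Φ s y h)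
    have d2 := H.right.dist_le_two_mul hK H.mul_le hs (x := Ψ s (Φ s y h) (j * h))
      (y := Φ s (Ψ s y (j * h)) h) (by linarith) (by linarith) hh
    have d3 := H.dist_swap_le hs hsT (b := Ψ s y (j * h)) (by linarith) hh
    have d4 := H.left.dist_le_two_mul hK H.mul_le hs (x := Ψ s y ((j + 1) * h))
      (y := Ψ s (Ψ s y (j * h)) h) (by linarith) (by linarith) hh
    have d5 := H.right.dist_succ_mul_le hs hyR hh hjε hη hgj
    rw [dist_comm] at d4
    have t1 := dist_triangle4 (Ψ s (Φ s y h) ((j + 1) * h)) (Ψ s (Ψ s (Φ s y h) (j * h)) h)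
      (Ψ s (Φ s (Ψ s y (j * h)) h) h) (Φ s (Ψ s (Ψ s y (j * h)) h) h)
    have t2 := dist_triangle (Ψ s (Φ s y h) ((j + 1) * h)) (Φ s (Ψ s (Ψ s y (j * h)) h) h)
      (Φ s (Ψ s y ((j + 1) * h)) h)
    have hpow : (1 : ℝ) ≤ 4 ^ j := one_le_pow₀ (by norm_num)
    have hKη : h * η ≤ K * (h * η) := le_mul_of_one_le_left hhη hK1
    have hW : 3 * K * (h * (η + h ^ α)) ≤ 4 ^ j * (3 * K * (h * (η + h ^ α))) :=
      le_mul_of_one_le_left (by positivity) hpow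
    have hWe : 3 * K * (h * (η + h ^ α)) = 3 * (K * (h * η)) + 3 * K * (h * h ^ α) := by ring
    have hW0 : 0 ≤ 3 * K * (h * (η + h ^ α)) := by positivity
    rw [pow_succ]
    linarith

/-- The defect of the alternating scheme when the last of `j + 1` equal steps is split off. -/
theorem dist_alternatingStep_le (H : CommutingBounds Φ Ψ a t R ε T K α g g') {s h η : ℝ} {x : X}
    (hs : s ∈ Set.Icc t T) (hsT : s + ε ≤ T) (hx : dist x a + 4 * (K * ε) < R)
    (hh : 0 ≤ h) (hη : 0 ≤ η) (j : ℕ) (hjh : (j + 1) * h ≤ ε)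
    (hg : ∀ i : ℕ, 1 ≤ i → i ≤ j → g (i * h) h ≤ η ∧ g' (i * h) h ≤ η) :
    dist (alternatingStep Φ Ψ s x ((j + 1) * h))
        (alternatingStep Φ Ψ (s + j * h) (alternatingStep Φ Ψ s x (j * h)) h)
      ≤ 12 * K * 4 ^ j * (h * (η + h ^ α)) := by
  have hK1 := H.one_le
  have hj0 : 0 ≤ j * h := by positivity
  have hhI : h ∈ Set.Icc 0 ε := ⟨hh, by linarith⟩
  have hK : 0 ≤ K := zero_le_one.trans hK1
  have hKε : 0 ≤ K * ε := mul_nonneg hK (hh.trans hhI.2)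
  have hp0 : 0 ≤ h ^ α := Real.rpow_nonneg hh α
  have hhη : 0 ≤ h * η := mul_nonneg hh hη
  have hhα : 0 ≤ h * h ^ α := mul_nonneg hh hp0
  have hjI : j * h ∈ Set.Icc 0 ε := ⟨hj0, by linarith⟩
  have hj1I : (j + 1) * h ∈ Set.Icc 0 ε := ⟨by positivity, hjh⟩
  have hs' : s + j * h ∈ Set.Icc t T := ⟨by linarith [hs.1], by linarith [hjI.2]⟩
  have hgΦ : 1 ≤ j → g (j * h) h ≤ η := fun h1 => (hg j h1 le_rfl).1
  have hgΨ : 1 ≤ j → g' (j * h) h ≤ η := fun h1 => (hg j h1 le_rfl).2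
  have hxR : dist x a < R := by linarith
  unfold alternatingStep
  set y := Φ s x (j * h)
  have p1 : dist y a ≤ _ := H.left.dist_center_le hK hs hxR hjI
  have p2 := H.left.dist_center_le hK hs hxR hj1I
  have p3 := H.left.dist_center_le hK hs (by linarith) hhI (x := y)
  have p4 := H.right.dist_center_le hK hs (by linarith) hjI (x := y)
  have p5 := H.right.dist_center_le hK hs (by linarith) hjI (x := Φ s y h)
  have p6 := H.left.dist_center_le hK hs (by linarith) hhI (x := Ψ s y (j * h))
  have p7 := H.left.dist_center_le hK hs' (by linarith) hhI (x := Ψ s y (j * h))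
  have d1 := H.left.dist_succ_mul_le hs hxR hhI hjI.2 hη hgΦ
  have d2 := H.right.dist_le_two_mul hK H.mul_le hs (by linarith) (by linarith) hj1I
    (x := Φ s x ((j + 1) * h)) (y := Φ s y h)
  have d3 := H.right.dist_succ_mul_le hs (by linarith) hhI hjI.2 hη hgΨ (x := Φ s y h)
  have d4 := H.dist_swap_mul_le hs hsT (y := y) (by linarith) hhI hη j hjI.2
    fun i h1 h2 => (hg i h1 h2.le).2
  have d5 := H.right.dist_le_two_mul hK H.mul_le hs (by linarith) (by linarith) hhI
    (x := Ψ s (Φ s y h) (j * h)) (y := Φ s (Ψ s y (j * h)) h)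
  have d6 := H.left.time (Ψ s y (j * h)) (by rw [Metric.mem_ball]; linarith) h hhI s hs _ hs'
  have d7 := H.right.dist_le_two_mul hK H.mul_le hs (by linarith) (by linarith) hhI
    (x := Φ s (Ψ s y (j * h)) h) (y := Φ (s + j * h) (Ψ s y (j * h)) h)
  have d8 := H.right.time (Φ (s + j * h) (Ψ s y (j * h)) h) (by rw [Metric.mem_ball]; linarith) h
    hhI s hs _ hs'
  rw [show s - (s + j * h) = -(j * h) by ring, abs_neg, abs_of_nonneg hj0] at d6 d8
  have t1 := dist_triangle4 (Ψ s (Φ s x ((j + 1) * h)) ((j + 1) * h)) (Ψ s (Φ s y h) ((j + 1) * h))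
    (Ψ s (Ψ s (Φ s y h) (j * h)) h) (Ψ s (Φ s (Ψ s y (j * h)) h) h)
  have t2 := dist_triangle4 (Ψ s (Φ s x ((j + 1) * h)) ((j + 1) * h))
    (Ψ s (Φ s (Ψ s y (j * h)) h) h) (Ψ s (Φ (s + j * h) (Ψ s y (j * h)) h) h)
    (Ψ (s + j * h) (Φ (s + j * h) (Ψ s y (j * h)) h) h)
  have hα := mul_le_mul_of_nonneg_left (natCast_mul_rpow_le H.exponent hh j)
    (mul_nonneg hK hh)
  have hpow : (1 : ℝ) ≤ 4 ^ j := one_le_pow₀ (by norm_num)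
  have hKη : h * η ≤ 4 ^ j * (K * (h * η)) :=
    (le_mul_of_one_le_left hhη hK1).trans (le_mul_of_one_le_left (by positivity) hpow)
  have e1 : K * h * (4 ^ j * h ^ α) = 4 ^ j * (K * (h * h ^ α)) := by ring
  have e2 : 4 ^ j * (3 * K * (h * (η + h ^ α)))
    = 3 * (4 ^ j * (K * (h * η))) + 3 * (4 ^ j * (K * (h * h ^ α))) := by ring
  have e3 : 12 * K * 4 ^ j * (h * (η + h ^ α))
    = 12 * (4 ^ j * (K * (h * η))) + 12 * (4 ^ j * (K * (h * h ^ α))) := by ring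
  have z1 : 0 ≤ 4 ^ j * (K * (h * η)) := by positivity
  have z2 : 0 ≤ 4 ^ j * (K * (h * h ^ α)) := by positivity
  linarith

end CommutingBounds

theorem CommutingBounds.mono {X : Type*} [MetricSpace X] {Φ Ψ : ℝ → X → ℝ → X} {a : X}
    {t R ε T K α : ℝ} {g g' : ℝ → ℝ → ℝ} (H : CommutingBounds Φ Ψ a t R ε T K α g g') {ε' : ℝ}
    (hε : ε' ≤ ε) (hT : T ≤ t + 1) : CommutingBounds Φ Ψ a t R ε' T K α g g' := by
  have hK : 0 ≤ K := zero_le_one.trans H.one_le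
  refine ⟨H.left.mono le_rfl hε le_rfl hT hK le_rfl H.exponent.1.le le_rfl,
    H.right.mono le_rfl hε le_rfl hT hK le_rfl H.exponent.1.le le_rfl, H.one_le,
    (mul_le_mul_of_nonneg_left hε hK).trans H.mul_le, H.exponent, ?_⟩
  exact fun b hb h hh s hs hsh => H.comm b hb h ⟨hh.1, hh.2.trans hε⟩ s hs hsh

theorem exists_commutingBounds {X : Type*} [MetricSpace X] {Φ Ψ : ℝ → X → ℝ → X}
    (hΦarc : IsArcField Φ) (hΨarc : IsArcField Ψ) (hAΦ : CondA Φ) (hBΦ : CondB Φ)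
    (hCΦ : CondC Φ) (hAΨ : CondA Ψ) (hBΨ : CondB Ψ) (hCΨ : CondC Ψ) (hD : CondD Φ Ψ) (a : X)
    {t : ℝ} (ht : 0 ≤ t) :
    ∃ R > 0, ∃ ε > 0, ∃ T > t, ∃ K α : ℝ, ∃ g g' : ℝ → ℝ → ℝ, T ≤ t + 1 ∧
      (∃ r ≥ R, IsComplete (Metric.closedBall a r)) ∧
        CommutingBounds Φ Ψ a t R ε T K α g g' := by
  obtain ⟨R₁, hR₁, ε₁, hε₁, T₁, hT₁, K₁, hK₁, α₁, hα₁, g, ⟨r, hr, hcomp⟩, hΦ⟩ :=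
    exists_arcFieldBounds hΦarc hAΦ hBΦ hCΦ a ht
  obtain ⟨R₂, hR₂, ε₂, hε₂, T₂, hT₂, K₂, hK₂, α₂, hα₂, g', -, hΨ⟩ :=
    exists_arcFieldBounds hΨarc hAΨ hBΨ hCΨ a ht
  obtain ⟨α₃, hα₃, C, hC, hD⟩ := hD
  obtain ⟨R₃, hR₃, ε₃, hε₃, T₃, hT₃, K₃, hD⟩ := hD a t ht
  set R := min R₁ (min R₂ R₃)
  have r₁ : R ≤ R₁ := min_le_left _ _
  have r₂ : R ≤ R₂ := (min_le_right _ _).trans (min_le_left _ _)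
  have r₃ : R ≤ R₃ := (min_le_right _ _).trans (min_le_right _ _)
  set K := max 1 (max (max K₁ K₂) C)
  have k₀ : 1 ≤ K := le_max_left _ _
  have k₁ : K₁ ≤ K := (le_max_left _ _).trans ((le_max_left _ _).trans (le_max_right _ _))
  have k₂ : K₂ ≤ K := (le_max_right _ _).trans ((le_max_left _ _).trans (le_max_right _ _))
  have k₃ : C ≤ K := (le_max_right _ _).trans (le_max_right _ _)
  set ε := min (min ε₁ ε₂) (min ε₃ (1 / K))
  have e₁ : ε ≤ ε₁ := (min_le_left _ _).trans (min_le_left _ _)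
  have e₂ : ε ≤ ε₂ := (min_le_left _ _).trans (min_le_right _ _)
  have e₃ : ε ≤ ε₃ := (min_le_right _ _).trans (min_le_left _ _)
  have e₄ : ε ≤ 1 / K := (min_le_right _ _).trans (min_le_right _ _)
  set T := min (min T₁ T₂) (min T₃ (t + 1))
  have t₁ : T ≤ T₁ := (min_le_left _ _).trans (min_le_left _ _)
  have t₂ : T ≤ T₂ := (min_le_left _ _).trans (min_le_right _ _)
  have t₃ : T ≤ T₃ := (min_le_right _ _).trans (min_le_left _ _)
  have t₄ : T ≤ t + 1 := (min_le_right _ _).trans (min_le_right _ _)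
  set α := min α₁ (min α₂ α₃)
  have a₁ : α ≤ α₁ := min_le_left _ _
  have a₂ : α ≤ α₂ := (min_le_right _ _).trans (min_le_left _ _)
  have a₃ : α ≤ α₃ := (min_le_right _ _).trans (min_le_right _ _)
  have hα : α ∈ Set.Ioo (0 : ℝ) 1 := ⟨lt_min hα₁.1 (lt_min hα₂.1 hα₃.1), a₁.trans_lt hα₁.2⟩
  have hK : 0 < K := zero_lt_one.trans_le k₀
  refine ⟨R, lt_min hR₁ (lt_min hR₂ hR₃), ε,
    lt_min (lt_min hε₁ hε₂) (lt_min hε₃.1 (by positivity)), T,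
    lt_min (lt_min hT₁ hT₂) (lt_min hT₃ (by linarith)), K, α, g, g', t₄, ⟨r, r₁.trans hr, hcomp⟩,
    hΦ.mono r₁ e₁ t₁ t₄ hK₁ k₁ hα.1.le a₁, hΨ.mono r₂ e₂ t₂ t₄ hK₂ k₂ hα.1.le a₂, k₀, ?_, hα, ?_⟩
  · rw [le_div_iff₀ hK] at e₄
    linarith
  · intro b hb h hh s hs hsh
    have hb' := Metric.ball_subset_ball r₃ hb
    refine (hD b hb' b hb' h ⟨hh.1, hh.2.trans e₃⟩ s ⟨hs.1, hs.2.trans t₃⟩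
      ⟨by linarith [hs.1, hh.1], hsh.trans t₃⟩).trans ?_
    rw [dist_self, zero_mul, zero_add]
    have h1 := Real.rpow_le_rpow_of_exponent_ge' hh.1 (hh.2.trans (e₃.trans hε₃.2))
      (by linarith [hα.1] : 0 ≤ 1 + α) (by linarith : 1 + α ≤ 1 + α₃)
    have := hh.1
    gcongr

theorem ArcFieldBounds.exists_g_le {X : Type*} [MetricSpace X] {Φ : ℝ → X → ℝ → X} {a : X}
    {t R ε T K α : ℝ} {g : ℝ → ℝ → ℝ} (hΦ : ArcFieldBounds Φ a t R ε T K α g) {y : ℝ}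
    (hy : 0 < y) : ∃ θ > 0, ∀ u v, 0 < u → u < θ → 0 < v → v < θ → g u v ≤ y := by
  have h1 := hΦ.g_tendsto.eventually (ge_mem_nhds hy)
  obtain ⟨θ, hθ, h2⟩ := ((nhdsGT_basis (0 : ℝ)).prod_self.eventually_iff).1 h1
  exact ⟨θ, hθ, fun u v hu hu' hv hv' => h2 (x := (u, v)) ⟨⟨hu, hu'⟩, hv, hv'⟩⟩

theorem CommutingBounds.isConsistentScheme {X : Type*} [MetricSpace X] {Φ Ψ : ℝ → X → ℝ → X}
    {a : X} {t R T K α c : ℝ} {g g' : ℝ → ℝ → ℝ} {n₀ : ℕ}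
    (H : CommutingBounds Φ Ψ a t R (1 / 2 ^ n₀) T K α g g')
    (hcT : t + c + 1 / 2 ^ n₀ ≤ T) (hcR : 3 * K * c < R / 2) (hR : 4 * (K * (1 / 2 ^ n₀)) < R / 2) :
    IsConsistentScheme (alternatingStep Φ Ψ) a t c (R / 2) (3 * K) (1 / 2 ^ n₀)
      (fun n => 48 * K * (g (1 / 2 ^ (n + (n₀ + 1))) (1 / 2 ^ (n + (n₀ + 1)))
        + g' (1 / 2 ^ (n + (n₀ + 1))) (1 / 2 ^ (n + (n₀ + 1)))
        + ((1 / 2 : ℝ) ^ α) ^ (n + (n₀ + 1)))) := by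
  have hK1 := H.one_le
  have hK : 0 ≤ K := zero_le_one.trans hK1
  have hε : (0 : ℝ) < 1 / 2 ^ n₀ := by positivity
  have hHn : ∀ n : ℕ, (1 : ℝ) / 2 ^ n₀ / 2 ^ n / 2 = 1 / 2 ^ (n + (n₀ + 1)) := by
    intro n; rw [pow_add, pow_succ]; field_simp
  have hhalf : ∀ n : ℕ, (1 : ℝ) / 2 ^ n₀ / 2 ^ n ≤ 1 / 2 ^ n₀ :=
    fun n => div_le_self hε.le (one_le_pow₀ one_le_two)
  have hεK := H.mul_le
  set ε : ℝ := 1 / 2 ^ n₀ with hεdef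
  clear_value ε
  have hKε : 0 ≤ K * ε := by positivity
  have hI : ∀ s ∈ Set.Icc t (t + c), s ∈ Set.Icc t T := fun s hs => ⟨hs.1, by linarith [hs.2]⟩
  have hB : ∀ x ∈ Metric.ball a (R / 2), dist x a + 4 * (K * ε) < R := by
    intro x hx
    rw [Metric.mem_ball] at hx
    linarith
  have hP : ∀ s ∈ Set.Icc t T, ∀ x ∈ Metric.ball a (R / 2), ∀ h ∈ Set.Icc 0 ε,
      dist (Φ s x h) a < R := by
    intro s hs x hx h hh
    have := H.left.dist_center_le hK hs (x := x) (by linarith [hB x hx]) hh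
    linarith [hB x hx]
  have hR' : ∀ x ∈ Metric.ball a (R / 2), dist x a < R := fun x hx => by linarith [hB x hx]
  constructor
  · positivity
  · exact hε
  · exact hcR
  · intro s x
    simp [alternatingStep, H.left.zero, H.right.zero]
  · intro s hs x hx h hh h' hh'
    have hs := hI s hs
    have h1 := H.right.step _ (hP s hs x hx h hh) s hs h hh h' hh'
    have h2 := H.left.step x (hR' x hx) s hs h hh h' hh'
    have h3 := H.right.dist_le_two_mul hK hεK hs (hP s hs x hx h hh) (hP s hs x hx h' hh') hh'
    have := dist_triangle (Ψ s (Φ s x h) h) (Ψ s (Φ s x h) h') (Ψ s (Φ s x h') h')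
    unfold alternatingStep
    linarith
  · intro s hs x hx y hy h hh
    have hs := hI s hs
    have h1 := H.right.space _ (hP s hs x hx h hh) _ (hP s hs y hy h hh) h hh s hs
    have h2 := H.left.space x (hR' x hx) y (hR' y hy) h hh s hs
    have h0 := hh.1
    have hKh : 0 ≤ h * K := mul_nonneg h0 hK
    have hKh1 : h * K ≤ 1 := by
      have := mul_le_mul_of_nonneg_left hh.2 hK
      linarith
    refine h1.trans ((mul_le_mul_of_nonneg_right h2 (by linarith)).trans ?_)
    rw [mul_assoc, mul_comm]
    refine mul_le_mul_of_nonneg_right ?_ dist_nonneg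
    nlinarith
  · intro ζ hζ
    obtain ⟨θ, hθ, hle⟩ := exists_pos_rpow_le H.exponent.1 (y := ζ / (3 * K)) (by positivity)
    refine ⟨θ, hθ, fun s hs s' hs' hss x hx h hh => ?_⟩
    have hs := hI s hs
    have hs' := hI s' hs'
    have h0 := hh.1
    have h1 := H.left.time x (hR' x hx) h hh s hs s' hs'
    have h2 := H.right.dist_le_two_mul hK hεK hs (hP s hs x hx h hh) (hP s' hs' x hx h hh) hh
    have h3 := H.right.time _ (hP s' hs' x hx h hh) h hh s hs s' hs'
    have := dist_triangle (Ψ s (Φ s x h) h) (Ψ s (Φ s' x h) h) (Ψ s' (Φ s' x h) h)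
    have h4 := hle _ (abs_nonneg (s - s')) hss
    rw [le_div_iff₀ (by positivity)] at h4
    have h5 := mul_le_mul_of_nonneg_left h4 h0
    unfold alternatingStep
    linarith
  · intro n s hs hsn x hx
    have hh0 : 0 ≤ ε / 2 ^ n / 2 := by positivity
    have hhε := hhalf n
    set h := ε / 2 ^ n / 2 with hh
    have e : ε / 2 ^ n = ((1 : ℕ) + 1) * h := by rw [hh]; push_cast; ring
    have hη : 0 ≤ g h h + g' h h := add_nonneg (H.left.g_nonneg _ _) (H.right.g_nonneg _ _)
    have key := H.dist_alternatingStep_le (hI s ⟨hs, by rw [e] at hsn; push_cast at hsn; linarith⟩)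
      (by rw [e] at hsn; push_cast at hsn; linarith) (hB x hx) hh0 hη 1
      (by rw [← e]; exact hhε) fun i hi1 hi2 => by
        obtain rfl : i = 1 := by omega
        simp only [Nat.cast_one, one_mul]
        exact ⟨by linarith [H.right.g_nonneg h h], by linarith [H.left.g_nonneg h h]⟩
    rw [← e, Nat.cast_one, one_mul] at key
    refine key.trans ?_
    have hhn : h = 1 / 2 ^ (n + (n₀ + 1)) := hHn n
    have hα : h ^ α = ((1 / 2 : ℝ) ^ α) ^ (n + (n₀ + 1)) := by
      rw [hhn, Real.rpow_pow_comm (by norm_num), one_div_pow]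
    rw [← hhn, ← hα]
    have hp0 : 0 ≤ h ^ α := Real.rpow_nonneg hh0 α
    have : 0 ≤ 48 * K * (h * (g h h + g' h h + h ^ α)) := by positivity
    have e2 : ε / 2 ^ n = 2 * h := by rw [hh]; ring
    rw [e2]
    linarith
  · intro n
    have := H.left.g_nonneg (1 / 2 ^ (n + (n₀ + 1))) (1 / 2 ^ (n + (n₀ + 1)))
    have := H.right.g_nonneg (1 / 2 ^ (n + (n₀ + 1))) (1 / 2 ^ (n + (n₀ + 1)))
    positivity
  · refine Summable.mul_left _ ((Summable.add ?_ ?_).add ?_)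
    · exact (summable_nat_add_iff (n₀ + 1)).2 H.left.g_summable
    · exact (summable_nat_add_iff (n₀ + 1)).2 H.right.g_summable
    · refine (summable_nat_add_iff (n₀ + 1)).2 (summable_geometric_of_lt_one (by positivity) ?_)
      exact Real.rpow_lt_one (by norm_num) (by norm_num) H.exponent.1
  · intro k ζ hζ
    set y := ζ / (24 * K * 4 ^ k) with hy
    have hy0 : 0 < y := by positivity
    obtain ⟨θ₁, hθ₁, hg⟩ := H.left.exists_g_le hy0
    obtain ⟨θ₂, hθ₂, hg'⟩ := H.right.exists_g_le hy0
    obtain ⟨θ₃, hθ₃, hα⟩ := exists_pos_rpow_le H.exponent.1 hy0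
    refine ⟨min (min θ₁ θ₂) (min θ₃ ε) / (k + 1), by positivity, ?_⟩
    intro h hh j hj s hs hsj x hx
    have h0 := hh.1
    have hkh := hh.2
    rw [lt_div_iff₀ (by positivity)] at hkh
    simp only [lt_min_iff] at hkh
    obtain ⟨⟨b1, b2⟩, b3, b4⟩ := hkh
    have hk1 : h ≤ h * (k + 1) := le_mul_of_one_le_right h0.le (by linarith [k.cast_nonneg (α := ℝ)])
    have hik : ∀ i : ℕ, i ≤ k → i * h ≤ h * (k + 1) := by
      intro i hi
      rw [mul_comm]
      have : (i : ℝ) ≤ k := by exact_mod_cast hi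
      exact mul_le_mul_of_nonneg_left (by linarith) h0.le
    have hj1 := hik (j + 1) hj
    push_cast at hj1
    have hjh : 0 ≤ (j + 1) * h := by positivity
    have key := H.dist_alternatingStep_le (hI s ⟨hs, by linarith⟩) (by linarith) (hB x hx) h0.le
      hy0.le j (by linarith) fun i hi1 hi2 => by
        have hi := hik i (by omega)
        have hi0 : 0 < i * h := by
          have : (0 : ℝ) < i := by exact_mod_cast hi1
          positivity
        exact ⟨hg _ _ hi0 (by linarith) h0 (by linarith),
          hg' _ _ hi0 (by linarith) h0 (by linarith)⟩
    refine key.trans ?_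
    have hαy := hα h h0.le (by linarith)
    have hpow : (4 : ℝ) ^ j ≤ 4 ^ k := pow_le_pow_right₀ (by norm_num) hj.le
    calc 12 * K * 4 ^ j * (h * (y + h ^ α)) ≤ 12 * K * 4 ^ k * (h * (y + y)) := by
          have := Real.rpow_nonneg h0.le α
          gcongr
      _ = ζ * h := by rw [hy]; field_simp; ring

/-- Existence of a solution curve for the sum of two arc fields (Theorem 3.5). -/
theorem existence_sum_solution_curve {X : Type*} [MetricSpace X]
    (Φ Ψ : ℝ → X → ℝ → X)
    (hΦarc : IsArcField Φ) (hΨarc : IsArcField Ψ)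
    (hAΦ : CondA Φ) (hBΦ : CondB Φ) (hCΦ : CondC Φ)
    (hAΨ : CondA Ψ) (hBΨ : CondB Ψ) (hCΨ : CondC Ψ)
    (hD : CondD Φ Ψ) :
    ∀ (a : X) (t : ℝ), 0 ≤ t → ∃ c > (0 : ℝ), ∃ σ : ℝ → X, σ t = a ∧
      ∀ s ∈ Set.Ico t (t + c),
        Filter.Tendsto
          (fun h => dist (σ (s + 2 * h)) (Ψ (s + h) (Φ s (σ s) (2 * h)) (2 * h)) / (2 * h))
          (nhdsWithin 0 (Set.Ioi 0)) (nhds 0) := by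
  intro a t ht
  obtain ⟨R, hR, ε, hε, T, hT, K, α, g, g', hT1, ⟨r, hr, hcomp⟩, H⟩ :=
    exists_commutingBounds hΦarc hΨarc hAΦ hBΦ hCΦ hAΨ hBΨ hCΨ hD a ht
  have hK : 0 < K := zero_lt_one.trans_le H.one_le
  obtain ⟨n₀, hn₀⟩ := exists_pow_lt_of_lt_one
    (show 0 < min ε (min ((T - t) / 2) (R / (8 * K))) from
      lt_min hε (lt_min (by linarith) (by positivity))) (one_half_lt_one (α := ℝ))
  rw [one_div_pow] at hn₀
  simp only [lt_min_iff] at hn₀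
  obtain ⟨hn1, hn2, hn3⟩ := hn₀
  have H := H.mono hn1.le hT1
  rw [lt_div_iff₀ (by positivity)] at hn3
  set c := min ((T - t) / 2) (R / (12 * K)) with hc
  have hc0 : 0 < c := lt_min (by linarith) (by positivity)
  have hc1 : c ≤ (T - t) / 2 := min_le_left _ _
  have hc2 : c ≤ R / (12 * K) := min_le_right _ _
  rw [le_div_iff₀ (by positivity)] at hc2
  have hE := H.isConsistentScheme (by linarith) (by linarith) (by linarith)
  obtain ⟨σ, hσt, hσb, hσ⟩ := hE.exists_curve hcomp (by linarith) hc0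
  refine ⟨c, hc0, σ, hσt, fun s hs => ?_⟩
  have hsb := hσb s hs
  rw [Metric.mem_ball] at hsb
  have hdouble : Filter.Tendsto (fun h : ℝ => 2 * h) (nhdsWithin 0 (Set.Ioi 0))
      (nhdsWithin 0 (Set.Ioi 0)) := by
    refine tendsto_nhdsWithin_iff.2 ⟨?_, ?_⟩
    · have : Filter.Tendsto (fun h : ℝ => 2 * h) (nhds 0) (nhds (2 * 0)) :=
        (continuous_const_mul (2 : ℝ)).tendsto 0
      rw [mul_zero] at this
      exact this.mono_left nhdsWithin_le_nhds
    · filter_upwards [self_mem_nhdsWithin] with h hh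
      exact mul_pos (two_pos : (0 : ℝ) < 2) (show 0 < h from hh)
  have hmain := (hσ s hs).comp hdouble
  have hpow : Filter.Tendsto (fun h : ℝ => K * h ^ α) (nhdsWithin 0 (Set.Ioi 0)) (nhds 0) := by
    have := ((Real.continuousAt_rpow_const 0 α (Or.inr H.exponent.1.le)).tendsto).const_mul K
    rw [Real.zero_rpow H.exponent.1.ne', mul_zero] at this
    exact this.mono_left nhdsWithin_le_nhds
  have hsum := hmain.add hpow
  rw [add_zero] at hsum
  refine squeeze_zero' ?_ ?_ hsum
  · filter_upwards [self_mem_nhdsWithin] with h hh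
    have : 0 < h := hh
    positivity
  · have hb : (0 : ℝ) < 1 / 2 ^ n₀ / 2 := by positivity
    filter_upwards [Ioo_mem_nhdsGT hb] with h hh
    have h0 : 0 < h := hh.1
    have hhε : 2 * h ∈ Set.Icc (0 : ℝ) (1 / 2 ^ n₀) := ⟨by positivity, by linarith [hh.2]⟩
    have hsI : s ∈ Set.Icc t T := ⟨hs.1, by linarith [hs.2]⟩
    have hsI' : s + h ∈ Set.Icc t T := ⟨by linarith [hs.1], by linarith [hs.2, hh.2]⟩
    have hcent := H.left.dist_center_le hK.le hsI (by linarith) hhε (x := σ s)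
    have htime := H.right.time (Φ s (σ s) (2 * h)) (by rw [Metric.mem_ball]; linarith) (2 * h) hhε
      s hsI (s + h) hsI'
    rw [show s - (s + h) = -h by ring, abs_neg, abs_of_pos h0] at htime
    have tri := dist_triangle (σ (s + 2 * h)) (alternatingStep Φ Ψ s (σ s) (2 * h))
      (Ψ (s + h) (Φ s (σ s) (2 * h)) (2 * h))
    have h2 : 0 < 2 * h := by positivity
    simp only [Function.comp]
    rw [div_add' _ _ _ h2.ne']
    refine div_le_div_of_nonneg_right ?_ h2.le
    refine tri.trans (add_le_add_right (htime.trans (le_of_eq ?_)) _)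
    ring
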